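/- Let h be a strictly concave distortion function. Then a copula C is universally optimal for h with linear cost if and only if C = C⁻, where C⁻(u,v) = max(u+v−1, 0); i.e., the counter-monotonic copula is the unique universally optimal copula. -/

import Mathlib

open MeasureTheory Set ProbabilityTheory

noncomputable section

variable {Ω : Type*} [MeasurableSpace Ω]

/-- An atomless probability measure: every non-null measurable set has a measurable
subset of strictly smaller positive measure. -/
def AtomlessProb (P : Measure Ω) : Prop :=
  ∀ A : Set Ω, MeasurableSet A → 0 < P A →
    ∃ B ⊆ A, MeasurableSet B ∧ 0 < P B ∧ P B < P A

/-- A distortion function: increasing on `[0,1]` with `h 0 = 0` and `h 1 = 1`. -/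
def IsDistortion (h : ℝ → ℝ) : Prop :=
  MonotoneOn h (Icc 0 1) ∧ h 0 = 0 ∧ h 1 = 1

/-- The distorted expectation `E^h[Z]`. -/
def distExp (P : Measure Ω) (h : ℝ → ℝ) (Z : Ω → ℝ) : ℝ :=
  (∫ x in Ioi (0:ℝ), h (P {ω | Z ω > x}).toReal) +
  (∫ x in Iio (0:ℝ), (h (P {ω | Z ω > x}).toReal - 1))

/-- Bounded measurable real random variable. -/
def IsBddRV (X : Ω → ℝ) : Prop :=
  Measurable X ∧ ∃ M : ℝ, ∀ ω, |X ω| ≤ M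

/-- X and Y are comonotonic. -/
def Comonotone (P : Measure Ω) (X Y : Ω → ℝ) : Prop :=
  ∃ f g : ℝ → ℝ, Monotone f ∧ Monotone g ∧
    ∀ᵐ ω ∂P, X ω = f (X ω + Y ω) ∧ Y ω = g (X ω + Y ω)

/-- X and Y are counter-monotonic: X and -Y are comonotonic. -/
def CounterMonotone (P : Measure Ω) (X Y : Ω → ℝ) : Prop :=
  Comonotone P X (fun ω => -Y ω)

def Submodular (c : ℝ → ℝ → ℝ) : Prop :=
  ∀ x₁ y₁ x₂ y₂ : ℝ,
    c (min x₁ x₂) (min y₁ y₂) + c (max x₁ x₂) (max y₁ y₂) ≤ c x₁ y₁ + c x₂ y₂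

def Supermodular (c : ℝ → ℝ → ℝ) : Prop :=
  ∀ x₁ y₁ x₂ y₂ : ℝ,
    c x₁ y₁ + c x₂ y₂ ≤ c (min x₁ x₂) (min y₁ y₂) + c (max x₁ x₂) (max y₁ y₂)

/-- c is monotone: increasing in each argument or decreasing in each argument. -/
def MonotoneCost (c : ℝ → ℝ → ℝ) : Prop :=
  Monotone (fun q : ℝ × ℝ => c q.1 q.2) ∨ Antitone (fun q : ℝ × ℝ => c q.1 q.2)

/-- A 2-copula. -/
def IsCopula (C : ℝ → ℝ → ℝ) : Prop :=
  (∀ u ∈ Icc (0:ℝ) 1, C u 0 = 0 ∧ C 0 u = 0 ∧ C u 1 = u ∧ C 1 u = u) ∧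
  (∀ u₁ u₂ v₁ v₂ : ℝ, u₁ ∈ Icc (0:ℝ) 1 → u₂ ∈ Icc (0:ℝ) 1 →
    v₁ ∈ Icc (0:ℝ) 1 → v₂ ∈ Icc (0:ℝ) 1 → u₁ ≤ u₂ → v₁ ≤ v₂ →
    0 ≤ C u₂ v₂ - C u₂ v₁ - C u₁ v₂ + C u₁ v₁)

/-- (X, Y) has copula C. -/
def HasCopula (P : Measure Ω) (X Y : Ω → ℝ) (C : ℝ → ℝ → ℝ) : Prop :=
  ∀ x y : ℝ, (P {ω | X ω ≤ x ∧ Y ω ≤ y}).toReal =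
    C (P {ω | X ω ≤ x}).toReal (P {ω | Y ω ≤ y}).toReal

/-- C is universally optimal for h with linear cost. -/
def UnivOptimal (P : Measure Ω) (h : ℝ → ℝ) (C : ℝ → ℝ → ℝ) : Prop :=
  ∀ X Y X' Y' : Ω → ℝ, IsBddRV X → IsBddRV Y → IsBddRV X' → IsBddRV Y' →
    HasCopula P X Y C → IdentDistrib X X' P P → IdentDistrib Y Y' P P →
    distExp P h (fun ω => X ω + Y ω) ≤ distExp P h (fun ω => X' ω + Y' ω)

/-- C is universally maximal for h with linear cost. -/
def UnivMaximal (P : Measure Ω) (h : ℝ → ℝ) (C : ℝ → ℝ → ℝ) : Prop :=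
  ∀ X Y X' Y' : Ω → ℝ, IsBddRV X → IsBddRV Y → IsBddRV X' → IsBddRV Y' →
    HasCopula P X Y C → IdentDistrib X X' P P → IdentDistrib Y Y' P P →
    distExp P h (fun ω => X' ω + Y' ω) ≤ distExp P h (fun ω => X ω + Y ω)

/-- C is universally optimal within a class 𝒞 of copulas for h with linear cost. -/
def UnivOptimalWithin (P : Measure Ω) (h : ℝ → ℝ) (C : ℝ → ℝ → ℝ)
    (𝒞 : Set (ℝ → ℝ → ℝ)) : Prop :=
  ∀ X Y X' Y' : Ω → ℝ, IsBddRV X → IsBddRV Y → IsBddRV X' → IsBddRV Y' →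
    HasCopula P X Y C → (∃ C' ∈ 𝒞, HasCopula P X' Y' C') →
    IdentDistrib X X' P P → IdentDistrib Y Y' P P →
    distExp P h (fun ω => X ω + Y ω) ≤ distExp P h (fun ω => X' ω + Y' ω)

/-- C is universally maximal within a class 𝒞 of copulas for h with linear cost. -/
def UnivMaximalWithin (P : Measure Ω) (h : ℝ → ℝ) (C : ℝ → ℝ → ℝ)
    (𝒞 : Set (ℝ → ℝ → ℝ)) : Prop :=
  ∀ X Y X' Y' : Ω → ℝ, IsBddRV X → IsBddRV Y → IsBddRV X' → IsBddRV Y' →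
    HasCopula P X Y C → (∃ C' ∈ 𝒞, HasCopula P X' Y' C') →
    IdentDistrib X X' P P → IdentDistrib Y Y' P P →
    distExp P h (fun ω => X' ω + Y' ω) ≤ distExp P h (fun ω => X ω + Y ω)

/-- The set 𝒞_p of copulas C with C(1-p,1-p) = 1-p. -/
def copulaSet (p : ℝ) : Set (ℝ → ℝ → ℝ) :=
  {C | IsCopula C ∧ C (1 - p) (1 - p) = 1 - p}

/-- The "first comonotonic, then counter-monotonic" copula C^±_p. -/
def Cpm (p : ℝ) (u v : ℝ) : ℝ :=
  if min u v ≤ 1 - p then min u v else max (u + v - 1) (1 - p)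

/-- The "first counter-monotonic, then comonotonic" copula C^∓_p. -/
def Cmp (p : ℝ) (u v : ℝ) : ℝ :=
  if max u v ≤ 1 - p then max (u + v - 1 + p) 0 else min u v

/-- Inverse S-shaped distortion with inflection point p: continuous, concave on (0,p),
convex on (p,1). -/
def IsISS (h : ℝ → ℝ) (p : ℝ) : Prop :=
  ContinuousOn h (Icc 0 1) ∧ ConcaveOn ℝ (Ioo 0 p) h ∧ ConvexOn ℝ (Ioo p 1) h

/-- Strictly inverse S-shaped distortion with inflection point p. -/
def IsStrictISS (h : ℝ → ℝ) (p : ℝ) : Prop :=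
  ContinuousOn h (Icc 0 1) ∧ StrictConcaveOn ℝ (Ioo 0 p) h ∧ StrictConvexOn ℝ (Ioo p 1) h

/-- S-shaped distortion with inflection point p: continuous, convex on (0,p),
concave on (p,1). -/
def IsSS (h : ℝ → ℝ) (p : ℝ) : Prop :=
  ContinuousOn h (Icc 0 1) ∧ ConvexOn ℝ (Ioo 0 p) h ∧ ConcaveOn ℝ (Ioo p 1) h

/-- Strictly S-shaped distortion with inflection point p. -/
def IsStrictSS (h : ℝ → ℝ) (p : ℝ) : Prop :=
  ContinuousOn h (Icc 0 1) ∧ StrictConvexOn ℝ (Ioo 0 p) h ∧ StrictConcaveOn ℝ (Ioo p 1) h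

/-- Left quantile of Z at level t. -/
def leftQuantile (P : Measure Ω) (Z : Ω → ℝ) (t : ℝ) : ℝ :=
  sInf {x : ℝ | t ≤ (P {ω | Z ω ≤ x}).toReal}

/-- W is (a version of) the upper p-tail transform Z^∨_p of Z: its left-quantile
function is t ↦ Q_{(1-p)+pt}(Z). -/
def IsUpperTail (P : Measure Ω) (p : ℝ) (Z W : Ω → ℝ) : Prop :=
  ∀ t ∈ Ioc (0:ℝ) 1, leftQuantile P W t = leftQuantile P Z ((1 - p) + p * t)

/-- W is (a version of) the lower tail transform Z^∧_p of Z: its left-quantile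
function is t ↦ Q_{(1-p)t}(Z). -/
def IsLowerTail (P : Measure Ω) (p : ℝ) (Z W : Ω → ℝ) : Prop :=
  ∀ t ∈ Ioc (0:ℝ) 1, leftQuantile P W t = leftQuantile P Z ((1 - p) * t)

/-- Expected Shortfall at level p. -/
def ES (P : Measure Ω) (p : ℝ) (Z : Ω → ℝ) : ℝ :=
  (1 / (1 - p)) * ∫ r in p..1, leftQuantile P Z r

/-- In an atomless space, every non-null set has subsets of arbitrarily small positive measure. -/
lemma AtomlessProb.exists_small {P : Measure Ω} [IsProbabilityMeasure P] (hP : AtomlessProb P)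
    {A : Set Ω} (hA : MeasurableSet A) (hA0 : 0 < P.real A) {ε : ℝ} (hε : 0 < ε) :
    ∃ B ⊆ A, MeasurableSet B ∧ 0 < P.real B ∧ P.real B < ε := by
  have half : ∀ n : ℕ, ∃ B ⊆ A, MeasurableSet B ∧ 0 < P.real B ∧
      P.real B ≤ (1 / 2) ^ n * P.real A := by
    intro n
    induction n with
    | zero => exact ⟨A, subset_rfl, hA, hA0, by simp⟩
    | succ n ih =>
      obtain ⟨B, hBA, hB, hB0, hBn⟩ := ih
      obtain ⟨D, hDB, hD, hD0, hDlt⟩ := hP B hB (by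
        simpa [measureReal_def, ENNReal.toReal_pos_iff] using hB0)
      have hD0' : 0 < P.real D := ENNReal.toReal_pos hD0.ne' (measure_ne_top _ _)
      have hDlt' : P.real D < P.real B :=
        (ENNReal.toReal_lt_toReal (measure_ne_top _ _) (measure_ne_top _ _)).2 hDlt
      have hdiff : P.real (B \ D) = P.real B - P.real D := measureReal_sdiff hDB hD
      rcases le_total (P.real D) (P.real B / 2) with hle | hle
      · refine ⟨D, hDB.trans hBA, hD, hD0', ?_⟩
        rw [pow_succ]
        linarith
      · refine ⟨B \ D, sdiff_subset.trans hBA, hB.diff hD, by linarith, ?_⟩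
        rw [pow_succ]
        linarith
  obtain ⟨n, hn⟩ := exists_pow_lt_of_lt_one hε (show (1 / 2 : ℝ) < 1 by norm_num)
  obtain ⟨B, hBA, hB, hB0, hBn⟩ := half n
  refine ⟨B, hBA, hB, hB0, hBn.trans_lt (lt_of_le_of_lt ?_ hn)⟩
  exact mul_le_of_le_one_right (by positivity) measureReal_le_one

/-- Sierpiński's theorem: an atomless probability measure attains all intermediate values. -/
lemma AtomlessProb.exists_subset_measureReal_eq {P : Measure Ω} [IsProbabilityMeasure P]
    (hP : AtomlessProb P) {A : Set Ω} (hA : MeasurableSet A) {t : ℝ} (ht0 : 0 ≤ t)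
    (ht : t ≤ P.real A) : ∃ B ⊆ A, MeasurableSet B ∧ P.real B = t := by
  let S : Set (Set Ω) := {D | MeasurableSet D ∧ D ⊆ A ∧ P.real D ≤ t}
  have next : ∀ D : S, ∃ D' : S, (D : Set Ω) ⊆ D' ∧
      ∀ E ∈ S, (D : Set Ω) ⊆ E → P.real E + P.real D ≤ 2 * P.real D' := by
    rintro ⟨D, hD⟩
    let V : Set ℝ := (fun E => P.real E) '' {E | E ∈ S ∧ D ⊆ E}
    have hVb : BddAbove V := ⟨t, by rintro _ ⟨E, hE, rfl⟩; exact hE.1.2.2⟩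
    have hDV : P.real D ∈ V := ⟨D, ⟨hD, subset_rfl⟩, rfl⟩
    rcases (le_csSup hVb hDV).eq_or_lt with heq | hlt
    · refine ⟨⟨D, hD⟩, subset_rfl, fun E hE hDE => ?_⟩
      have : P.real E ≤ sSup V := le_csSup hVb ⟨E, ⟨hE, hDE⟩, rfl⟩
      simp only at *
      linarith
    · obtain ⟨_, ⟨D', ⟨hD', hDD'⟩, rfl⟩, hlt'⟩ := exists_lt_of_lt_csSup ⟨_, hDV⟩
        (show (P.real D + sSup V) / 2 < sSup V by linarith)
      refine ⟨⟨D', hD'⟩, hDD', fun E hE hDE => ?_⟩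
      have : P.real E ≤ sSup V := le_csSup hVb ⟨E, ⟨hE, hDE⟩, rfl⟩
      simp only at *
      linarith
  choose f hf hf' using next
  let D : ℕ → S := fun n => f^[n] ⟨∅, MeasurableSet.empty, empty_subset _, by simpa using ht0⟩
  have hDs : ∀ n, D (n + 1) = f (D n) := fun n => Function.iterate_succ_apply' f n _
  have hmono : Monotone fun n => (D n : Set Ω) :=
    monotone_nat_of_le_succ fun n => by rw [hDs]; exact hf _
  let B : Set Ω := ⋃ n, (D n : Set Ω)
  have hB : MeasurableSet B := MeasurableSet.iUnion fun n => (D n).2.1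
  have hBA : B ⊆ A := iUnion_subset fun n => (D n).2.2.1
  have hlim : Filter.Tendsto (fun n => P.real (D n : Set Ω)) Filter.atTop (nhds (P.real B)) :=
    (ENNReal.tendsto_toReal (measure_ne_top _ _)).comp (tendsto_measure_iUnion_atTop hmono)
  have hBt : P.real B ≤ t := le_of_tendsto' hlim fun n => (D n).2.2.2
  refine ⟨B, hBA, hB, hBt.antisymm (not_lt.1 fun hlt => ?_)⟩
  have hdiff : P.real (A \ B) = P.real A - P.real B := measureReal_sdiff hBA hB
  obtain ⟨E, hEA, hE, hE0, hEt⟩ := hP.exists_small (hA.diff hB)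
    (show 0 < P.real (A \ B) by linarith) (show 0 < t - P.real B by linarith)
  have hBE : P.real (B ∪ E) = P.real B + P.real E :=
    measureReal_union (disjoint_sdiff_right.mono_right hEA) hE
  have hmem : B ∪ E ∈ S :=
    ⟨hB.union hE, union_subset hBA (hEA.trans sdiff_subset), by linarith⟩
  have key : ∀ n, P.real (B ∪ E) + P.real (D n : Set Ω) ≤ 2 * P.real (D (n + 1) : Set Ω) :=
    fun n => by
      rw [hDs]
      exact hf' _ _ hmem ((subset_iUnion (fun n => (D n : Set Ω)) n).trans subset_union_left)
  have := le_of_tendsto_of_tendsto' (hlim.const_add (P.real (B ∪ E)))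
    ((hlim.comp (Filter.tendsto_add_atTop_nat 1)).const_mul 2) key
  linarith

lemma AtomlessProb.exists_measureReal_eq_inter_eq {P : Measure Ω} [IsProbabilityMeasure P]
    (hP : AtomlessProb P) {D : Set Ω} (hD : MeasurableSet D) {b d : ℝ} (hd0 : 0 ≤ d)
    (hdD : d ≤ P.real D) (hdb : d ≤ b) (hb : P.real D + b - d ≤ 1) :
    ∃ E, MeasurableSet E ∧ P.real E = b ∧ P.real (D ∩ E) = d := by
  obtain ⟨E₁, hE₁D, hE₁, h₁⟩ := hP.exists_subset_measureReal_eq hD hd0 hdD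
  obtain ⟨E₂, hE₂D, hE₂, h₂⟩ := hP.exists_subset_measureReal_eq hD.compl
    (show 0 ≤ b - d by linarith) (by rw [probReal_compl_eq_one_sub hD]; linarith)
  have hdisj : Disjoint E₁ E₂ := disjoint_compl_right.mono hE₁D hE₂D
  refine ⟨E₁ ∪ E₂, hE₁.union hE₂, by rw [measureReal_union hdisj hE₂]; linarith, ?_⟩
  have : D ∩ (E₁ ∪ E₂) = E₁ := by
    ext ω
    have := @hE₁D ω
    have := @hE₂D ω
    simp only [mem_inter_iff, mem_union, mem_compl_iff] at *
    tauto
  rw [this, h₁]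

/-- A monotone function has larger integral against a measure that is larger on upper sets. -/
lemma lintegral_le_lintegral_of_upperSet {μ ν : Measure ℝ} [SFinite μ] [SFinite ν]
    (H : ∀ W : Set ℝ, IsUpperSet W → μ W ≤ ν W) {k : ℝ → ENNReal} (hk : Monotone k) :
    ∫⁻ x, k x ∂μ ≤ ∫⁻ x, k x ∂ν := by
  have hkm : Measurable k := hk.measurable
  have layer : ∀ r : ENNReal, r = ∫⁻ s in Ioi (0 : ℝ), {s | ENNReal.ofReal s < r}.indicator 1 s := by
    intro r
    have hm : MeasurableSet {s : ℝ | ENNReal.ofReal s < r} :=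
      measurableSet_lt ENNReal.measurable_ofReal measurable_const
    rw [lintegral_indicator_one hm, Measure.restrict_apply hm]
    rcases eq_or_ne r ⊤ with rfl | hr
    · simp
    · lift r to NNReal using hr
      have : {s : ℝ | ENNReal.ofReal s < r} ∩ Ioi 0 = Ioo 0 (r : ℝ) := by
        ext s
        simp only [mem_inter_iff, mem_ofPred_eq, mem_Ioi, mem_Ioo]
        constructor
        · rintro ⟨h1, h2⟩
          refine ⟨h2, ?_⟩
          rwa [ENNReal.ofReal_lt_iff_lt_toReal h2.le ENNReal.coe_ne_top, ENNReal.coe_toReal] at h1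
        · rintro ⟨h2, h1⟩
          refine ⟨?_, h2⟩
          rwa [ENNReal.ofReal_lt_iff_lt_toReal h2.le ENNReal.coe_ne_top, ENNReal.coe_toReal]
      rw [this, Real.volume_Ioo]
      simp
  have swap : ∀ ρ : Measure ℝ, SFinite ρ →
      ∫⁻ x, k x ∂ρ = ∫⁻ s in Ioi (0 : ℝ), ρ {x | ENNReal.ofReal s < k x} := by
    intro ρ _
    have hm : MeasurableSet {p : ℝ × ℝ | ENNReal.ofReal p.2 < k p.1} :=
      measurableSet_lt (ENNReal.measurable_ofReal.comp measurable_snd) (hkm.comp measurable_fst)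
    calc ∫⁻ x, k x ∂ρ
        = ∫⁻ x, (∫⁻ s in Ioi (0 : ℝ),
            {p : ℝ × ℝ | ENNReal.ofReal p.2 < k p.1}.indicator 1 (x, s)) ∂ρ :=
          lintegral_congr fun x => layer (k x)
      _ = ∫⁻ s in Ioi (0 : ℝ), ∫⁻ x,
            {p : ℝ × ℝ | ENNReal.ofReal p.2 < k p.1}.indicator 1 (x, s) ∂ρ :=
          lintegral_lintegral_swap (μ := ρ) (ν := volume.restrict (Ioi 0))
            (f := fun x s => {p : ℝ × ℝ | ENNReal.ofReal p.2 < k p.1}.indicator 1 (x, s))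
            (measurable_one.indicator hm).aemeasurable
      _ = _ := by
          refine lintegral_congr fun s => ?_
          exact lintegral_indicator_one (s := {x | ENNReal.ofReal s < k x})
            (measurableSet_lt measurable_const hkm)
  rw [swap μ inferInstance, swap ν inferInstance]
  exact lintegral_mono fun s => H _ fun x y hxy hx => lt_of_lt_of_le hx (hk hxy)

/-- A nondecreasing concave function on `[0, 1]` has an antitone choice of supergradients. -/
lemma exists_antitoneOn_supergradient {h : ℝ → ℝ} (hmono : MonotoneOn h (Icc 0 1))
    (hconc : ConcaveOn ℝ (Icc 0 1) h) :
    ∃ m : ℝ → ℝ, AntitoneOn m (Ioc 0 1) ∧ (∀ g ∈ Ioc (0 : ℝ) 1, 0 ≤ m g) ∧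
      ∀ g ∈ Ioc (0 : ℝ) 1, ∀ f ∈ Icc (0 : ℝ) 1, h f ≤ h g + m g * (f - g) := by
  let sl : ℝ → Set ℝ := fun g => (fun s => (h g - h s) / (g - s)) '' Ico 0 g
  have hnn : ∀ g ∈ Ioc (0 : ℝ) 1, ∀ y ∈ sl g, 0 ≤ y := by
    rintro g hg _ ⟨s, hs, rfl⟩
    exact div_nonneg (sub_nonneg.2 (hmono ⟨hs.1, hs.2.le.trans hg.2⟩ ⟨hg.1.le, hg.2⟩ hs.2.le))
      (sub_nonneg.2 hs.2.le)
  have hne : ∀ g ∈ Ioc (0 : ℝ) 1, (sl g).Nonempty := fun g hg => ⟨_, 0, ⟨le_rfl, hg.1⟩, rfl⟩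
  have hbdd : ∀ g ∈ Ioc (0 : ℝ) 1, BddBelow (sl g) := fun g hg => ⟨0, hnn g hg⟩
  have right : ∀ g ∈ Ioc (0 : ℝ) 1, ∀ f, g < f → f ≤ 1 →
      (h f - h g) / (f - g) ≤ sInf (sl g) := by
    intro g hg f hgf hf
    refine le_csInf (hne g hg) ?_
    rintro _ ⟨s, hs, rfl⟩
    exact hconc.slope_anti_adjacent ⟨hs.1, hs.2.le.trans hg.2⟩ ⟨hg.1.le.trans hgf.le, hf⟩ hs.2 hgf
  refine ⟨fun g => sInf (sl g), ?_, fun g hg => le_csInf (hne g hg) (hnn g hg), ?_⟩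
  · intro g hg g' hg' hgg'
    rcases hgg'.eq_or_lt with rfl | hlt
    · exact le_rfl
    · exact (csInf_le (hbdd g' hg') ⟨g, ⟨hg.1.le, hlt⟩, rfl⟩).trans (right g hg g' hlt hg'.2)
  · intro g hg f hf
    rcases lt_trichotomy f g with hlt | rfl | hlt
    · have := csInf_le (hbdd g hg) ⟨f, ⟨hf.1, hlt⟩, rfl⟩
      rw [le_div_iff₀ (by linarith)] at this
      linarith
    · simp
    · have := right g hg f hlt hf.2
      rw [div_le_iff₀ (by linarith)] at this
      linarith

lemma IsDistortion.mem_Icc {h : ℝ → ℝ} (hd : IsDistortion h) {t : ℝ} (ht : t ∈ Icc (0 : ℝ) 1) :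
    h t ∈ Icc (0 : ℝ) 1 := by
  obtain ⟨hm, h0, h1⟩ := hd
  constructor
  · rw [← h0]; exact hm (by simp) ht ht.1
  · rw [← h1]; exact hm ht (by simp) ht.2

/-- Concave distortions preserve the increasing convex order, expressed through survival
functions. -/
lemma lintegral_distortion_le {h : ℝ → ℝ} (hd : IsDistortion h) (hconc : ConcaveOn ℝ (Icc 0 1) h)
    {μ : Measure ℝ} [SFinite μ] {F G : ℝ → ℝ} (hF : Antitone F) (hG : Antitone G)
    (hF01 : ∀ x, F x ∈ Icc (0 : ℝ) 1) (hG01 : ∀ x, G x ∈ Icc (0 : ℝ) 1)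
    (H : ∀ W : Set ℝ, IsUpperSet W →
      ∫⁻ x in W, ENNReal.ofReal (F x) ∂μ ≤ ∫⁻ x in W, ENNReal.ofReal (G x) ∂μ) :
    ∫⁻ x, ENNReal.ofReal (h (F x)) ∂μ ≤ ∫⁻ x, ENNReal.ofReal (h (G x)) ∂μ := by
  obtain ⟨m, hm, hm0, hsup⟩ := exists_antitoneOn_supergradient hd.1 hconc
  have h0 : h 0 = 0 := hd.2.1
  let k : ℝ → ENNReal := fun x => if G x = 0 then ⊤ else ENNReal.ofReal (m (G x))
  have hpos : ∀ x, G x ≠ 0 → G x ∈ Ioc (0 : ℝ) 1 := fun x hx =>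
    ⟨lt_of_le_of_ne (hG01 x).1 (Ne.symm hx), (hG01 x).2⟩
  have hk : Monotone k := by
    intro x y hxy
    by_cases hy : G y = 0
    · simp [k, hy]
    · have hx : G x ≠ 0 := ((hpos y hy).1.trans_le (hG hxy)).ne'
      simp only [k, hx, hy, if_false]
      exact ENNReal.ofReal_le_ofReal (hm (hpos y hy) (hpos x hx) (hG hxy))
  have hkG : ∀ x, k x * ENNReal.ofReal (G x) ≤ ENNReal.ofReal (h (G x)) := by
    intro x
    by_cases hx : G x = 0
    · simp [hx]
    · simp only [k, hx, if_false]
      rw [← ENNReal.ofReal_mul (hm0 _ (hpos x hx))]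
      have := hsup _ (hpos x hx) 0 (by simp)
      exact ENNReal.ofReal_le_ofReal (by linarith)
  have hpt : ∀ x, ENNReal.ofReal (h (F x)) + k x * ENNReal.ofReal (G x) ≤
      ENNReal.ofReal (h (G x)) + k x * ENNReal.ofReal (F x) := by
    intro x
    by_cases hx : G x = 0
    · rcases (hF01 x).1.eq_or_lt with hFx | hFx
      · simp [hx, ← hFx]
      · have : ENNReal.ofReal (F x) ≠ 0 := by simpa using hFx
        simp [k, hx, ENNReal.top_mul this]
    · simp only [k, hx, if_false]
      have hmx := hm0 _ (hpos x hx)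
      rw [← ENNReal.ofReal_mul hmx, ← ENNReal.ofReal_mul hmx,
        ← ENNReal.ofReal_add (hd.mem_Icc (hF01 x)).1 (mul_nonneg hmx (hG01 x).1),
        ← ENNReal.ofReal_add (hd.mem_Icc (hG01 x)).1 (mul_nonneg hmx (hF01 x).1)]
      have := hsup _ (hpos x hx) _ (hF01 x)
      exact ENNReal.ofReal_le_ofReal (by linarith)
  have hFm : Measurable fun x => ENNReal.ofReal (F x) := ENNReal.measurable_ofReal.comp hF.measurable
  have hGm : Measurable fun x => ENNReal.ofReal (G x) := ENNReal.measurable_ofReal.comp hG.measurable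
  have hle : ∫⁻ x, k x * ENNReal.ofReal (F x) ∂μ ≤ ∫⁻ x, k x * ENNReal.ofReal (G x) ∂μ := by
    have := lintegral_le_lintegral_of_upperSet
      (μ := μ.withDensity fun x => ENNReal.ofReal (F x))
      (ν := μ.withDensity fun x => ENNReal.ofReal (G x)) (fun W hW => by
        rw [withDensity_apply _ hW.ordConnected.measurableSet,
          withDensity_apply _ hW.ordConnected.measurableSet]
        exact H W hW) hk
    rw [lintegral_withDensity_eq_lintegral_mul _ hFm hk.measurable,
      lintegral_withDensity_eq_lintegral_mul _ hGm hk.measurable] at this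
    simpa only [Pi.mul_apply, mul_comm] using this
  rcases eq_or_ne (∫⁻ x, ENNReal.ofReal (h (G x)) ∂μ) ⊤ with htop | htop
  · rw [htop]; exact le_top
  have hfin : ∫⁻ x, k x * ENNReal.ofReal (G x) ∂μ ≠ ⊤ :=
    ne_top_of_le_ne_top htop (lintegral_mono hkG)
  refine (ENNReal.add_le_add_iff_right hfin).1 ?_
  calc _ = ∫⁻ x, (ENNReal.ofReal (h (F x)) + k x * ENNReal.ofReal (G x)) ∂μ :=
        (lintegral_add_right _ (hk.measurable.mul hGm)).symm
    _ ≤ ∫⁻ x, (ENNReal.ofReal (h (G x)) + k x * ENNReal.ofReal (F x)) ∂μ := lintegral_mono hpt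
    _ = ∫⁻ x, ENNReal.ofReal (h (G x)) ∂μ + ∫⁻ x, k x * ENNReal.ofReal (F x) ∂μ :=
        lintegral_add_right _ (hk.measurable.mul hFm)
    _ ≤ _ := by gcongr

lemma antitone_survival (P : Measure Ω) [IsFiniteMeasure P] (Z : Ω → ℝ) :
    Antitone fun x => (P {ω | Z ω > x}).toReal := fun _ _ hxy =>
  ENNReal.toReal_mono (measure_ne_top _ _) (measure_mono fun _ hω => lt_of_le_of_lt hxy hω)

lemma survival_mem_Icc (P : Measure Ω) [IsProbabilityMeasure P] (Z : Ω → ℝ) (x : ℝ) :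
    (P {ω | Z ω > x}).toReal ∈ Icc (0 : ℝ) 1 :=
  ⟨ENNReal.toReal_nonneg, measureReal_le_one⟩

/-- Up to a shift, the distorted expectation of a bounded variable is a single integral of a
nonnegative function. -/
lemma distExp_add_eq {P : Measure Ω} [IsProbabilityMeasure P] {h : ℝ → ℝ} (hd : IsDistortion h)
    {Z : Ω → ℝ} {L : ℝ} (hL : ∀ ω, |Z ω| ≤ L) (hL0 : 0 ≤ L) :
    distExp P h Z + L =
        (∫⁻ x in Ioi (-L), ENNReal.ofReal (h (P {ω | Z ω > x}).toReal)).toReal ∧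
      ∫⁻ x in Ioi (-L), ENNReal.ofReal (h (P {ω | Z ω > x}).toReal) ≠ ⊤ := by
  set f : ℝ → ℝ := fun x => h (P {ω | Z ω > x}).toReal with hf
  have hf0 : ∀ x, 0 ≤ f x := fun x => (hd.mem_Icc (survival_mem_Icc P Z x)).1
  have hanti : Antitone f := fun x y hxy =>
    hd.1 (survival_mem_Icc P Z y) (survival_mem_Icc P Z x) (antitone_survival P Z hxy)
  have hhi : ∀ x, L ≤ x → f x = 0 := by
    intro x hx
    have : {ω | Z ω > x} = ∅ := by
      ext ω
      simpa using (abs_le.1 (hL ω)).2.trans hx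
    simp [hf, this, hd.2.1]
  have hlo : ∀ x, x < -L → f x = 1 := by
    intro x hx
    have : {ω | Z ω > x} = univ := by
      ext ω
      simpa using hx.trans_le (abs_le.1 (hL ω)).1
    simp [hf, this, hd.2.2]
  have hIcc : ∀ a b, IntegrableOn f (Icc a b) := fun a b =>
    (hanti.antitoneOn _).integrableOn_isCompact isCompact_Icc
  have hIoi : ∀ a, IntegrableOn f (Ioi a) := fun a =>
    (hIcc a L).of_forall_sdiff_eq_zero measurableSet_Ioi fun x hx => hhi x (by
      by_contra hlt
      exact hx.2 ⟨(mem_Ioi.1 hx.1).le, (not_le.1 hlt).le⟩)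
  have hneg : ∫ x in Iio (0 : ℝ), (f x - 1) = (∫ x in Ioc (-L) 0, f x) - L := by
    rw [← integral_Iic_eq_integral_Iio]
    rw [setIntegral_eq_of_subset_of_forall_sdiff_eq_zero (s := Icc (-L) 0) measurableSet_Iic
      (fun x hx => hx.2) (fun x hx => by
        rw [hlo x (by
          by_contra hlt
          exact hx.2 ⟨not_lt.1 hlt, hx.1⟩), sub_self])]
    rw [integral_Icc_eq_integral_Ioc, integral_sub ((hIcc _ _).mono_set Ioc_subset_Icc_self)
      (by simp)]
    simp [hL0]
  have hsplit : ∫ x in Ioi (-L), f x = (∫ x in Ioc (-L) 0, f x) + ∫ x in Ioi (0 : ℝ), f x := by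
    rw [← Ioc_union_Ioi_eq_Ioi (show -L ≤ 0 by linarith)]
    exact setIntegral_union Ioc_disjoint_Ioi_same measurableSet_Ioi
      ((hIcc _ _).mono_set Ioc_subset_Icc_self) (hIoi 0)
  have hlin : ∫ x in Ioi (-L), f x = (∫⁻ x in Ioi (-L), ENNReal.ofReal (f x)).toReal :=
    integral_eq_lintegral_of_nonneg_ae (ae_of_all _ hf0) (hIoi _).aestronglyMeasurable
  refine ⟨?_, ?_⟩
  · rw [← hlin, hsplit]
    change (∫ x in Ioi (0 : ℝ), f x) + (∫ x in Iio (0 : ℝ), (f x - 1)) + L = _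
    rw [hneg]
    ring
  · exact ((hasFiniteIntegral_iff_ofReal (ae_of_all _ hf0)).1 (hIoi _).2).ne

/-- The expected length of a random interval is the integral of its coverage probabilities. -/
lemma lintegral_ofReal_sub_eq {P : Measure Ω} [SFinite P] {U V : Ω → ℝ} (hU : Measurable U)
    (hV : Measurable V) :
    ∫⁻ ω, ENNReal.ofReal (V ω - U ω) ∂P = ∫⁻ t : ℝ, P {ω | U ω < t ∧ t < V ω} := by
  have hm : MeasurableSet {p : Ω × ℝ | U p.1 < p.2 ∧ p.2 < V p.1} :=
    (measurableSet_lt (hU.comp measurable_fst) measurable_snd).inter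
      (measurableSet_lt measurable_snd (hV.comp measurable_fst))
  calc ∫⁻ ω, ENNReal.ofReal (V ω - U ω) ∂P
      = ∫⁻ ω, (∫⁻ t : ℝ, {p : Ω × ℝ | U p.1 < p.2 ∧ p.2 < V p.1}.indicator 1 (ω, t)) ∂P := by
        refine lintegral_congr fun ω => ?_
        rw [← Real.volume_Ioo]
        exact (lintegral_indicator_one (s := Ioo (U ω) (V ω)) measurableSet_Ioo).symm
    _ = ∫⁻ t : ℝ, ∫⁻ ω, {p : Ω × ℝ | U p.1 < p.2 ∧ p.2 < V p.1}.indicator 1 (ω, t) ∂P :=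
        lintegral_lintegral_swap
          (f := fun ω (t : ℝ) => {p : Ω × ℝ | U p.1 < p.2 ∧ p.2 < V p.1}.indicator 1 (ω, t))
          (measurable_one.indicator hm).aemeasurable
    _ = _ := by
        refine lintegral_congr fun t => ?_
        exact lintegral_indicator_one (s := {ω | U ω < t ∧ t < V ω})
          ((measurableSet_lt hU measurable_const).inter (measurableSet_lt measurable_const hV))

/-- The integrated survival function of a sum in terms of joint survival probabilities. -/
lemma setLIntegral_survival_add {P : Measure Ω} [SFinite P] {X Y : Ω → ℝ} (hX : Measurable X)
    (hY : Measurable Y) (a : ℝ) :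
    ∫⁻ t in Ioi a, P {ω | X ω + Y ω > t} = ∫⁻ t, P {ω | X ω > t ∧ Y ω > a - t} := by
  have h1 := lintegral_ofReal_sub_eq (P := P) (measurable_const (a := a)) (hX.add hY)
  have h2 := lintegral_ofReal_sub_eq (P := P) (hY.const_sub a) hX
  have h3 : ∀ ω, (X + Y) ω - a = X ω - (a - Y ω) := fun ω => by simp; ring
  simp only [h3] at h1
  rw [← lintegral_indicator measurableSet_Ioi]
  calc ∫⁻ t, (Ioi a).indicator (fun t => P {ω | X ω + Y ω > t}) t
      = ∫⁻ t, P {ω | a < t ∧ t < (X + Y) ω} := by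
        refine lintegral_congr fun t => ?_
        by_cases ht : a < t <;> simp [indicator, ht]
    _ = ∫⁻ t, P {ω | a - Y ω < t ∧ t < X ω} := h1.symm.trans h2
    _ = _ := by
        refine lintegral_congr fun t => ?_
        congr 1
        ext ω
        simp only [mem_ofPred_eq, gt_iff_lt, sub_lt_comm (a := a)]
        tauto

lemma measureReal_gt_and_gt {P : Measure Ω} [IsProbabilityMeasure P] {X Y : Ω → ℝ}
    (hX : Measurable X) (hY : Measurable Y) (t s : ℝ) :
    P.real {ω | X ω > t ∧ Y ω > s} =
      1 - P.real {ω | X ω ≤ t} - P.real {ω | Y ω ≤ s} + P.real {ω | X ω ≤ t ∧ Y ω ≤ s} := by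
  have hA : MeasurableSet {ω | X ω ≤ t} := measurableSet_le hX measurable_const
  have hB : MeasurableSet {ω | Y ω ≤ s} := measurableSet_le hY measurable_const
  have h1 := measureReal_union_add_inter (μ := P) (s := {ω | X ω ≤ t}) hB
  have h2 := probReal_compl_eq_one_sub (μ := P) (hA.union hB)
  have h3 : ({ω | X ω ≤ t} ∪ {ω | Y ω ≤ s})ᶜ = {ω | X ω > t ∧ Y ω > s} := by
    ext ω
    simp
  have h4 : {ω | X ω ≤ t} ∩ {ω | Y ω ≤ s} = {ω | X ω ≤ t ∧ Y ω ≤ s} := rfl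
  rw [h3] at h2
  rw [h4] at h1
  linarith

/-- Inequality of stop-loss transforms yields inequality of integrals over all upper sets. -/
lemma setLIntegral_le_of_upperSet {F G : ℝ → ENNReal} (L : ℝ)
    (H : ∀ a, ∫⁻ t in Ioi a, F t ≤ ∫⁻ t in Ioi a, G t) {W : Set ℝ} (hW : IsUpperSet W) :
    ∫⁻ t in W, F t ∂(volume.restrict (Ioi L)) ≤ ∫⁻ t in W, G t ∂(volume.restrict (Ioi L)) := by
  rw [Measure.restrict_restrict hW.ordConnected.measurableSet]
  set V := W ∩ Ioi L with hVdef
  rcases V.eq_empty_or_nonempty with hV | hV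
  · simp [hV]
  have hbdd : BddBelow V := ⟨L, fun x hx => (mem_Ioi.1 hx.2).le⟩
  have hup : IsUpperSet V := hW.inter (isUpperSet_Ioi L)
  have hIci : V ⊆ Ici (sInf V) := fun x hx => csInf_le hbdd hx
  have hIoi : Ioi (sInf V) ⊆ V := fun x hx => by
    obtain ⟨y, hy, hyx⟩ := exists_lt_of_csInf_lt hV hx
    exact hup hyx.le hy
  have hae : V =ᵐ[volume] Ioi (sInf V) := by
    refine Filter.EventuallyLE.antisymm ?_ (Filter.Eventually.of_forall hIoi)
    filter_upwards [Ioi_ae_eq_Ici (μ := volume) (a := sInf V)] with x hx hxV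
    exact hx.symm ▸ hIci hxV
  rw [setLIntegral_congr hae, setLIntegral_congr hae]
  exact H _

/-- Among all couplings of given marginals, the counter-monotonic copula minimizes joint survival
probabilities. -/
lemma measure_gt_and_gt_le {P : Measure Ω} [IsProbabilityMeasure P] {C : ℝ → ℝ → ℝ}
    (hC : ∀ u ∈ Icc (0 : ℝ) 1, ∀ v ∈ Icc (0 : ℝ) 1, C u v = max (u + v - 1) 0)
    {X Y X' Y' : Ω → ℝ} (hX : Measurable X) (hY : Measurable Y) (hX' : Measurable X')
    (hY' : Measurable Y') (hXY : HasCopula P X Y C) (hXX' : IdentDistrib X X' P P)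
    (hYY' : IdentDistrib Y Y' P P) (t s : ℝ) :
    P {ω | X ω > t ∧ Y ω > s} ≤ P {ω | X' ω > t ∧ Y' ω > s} := by
  rw [← ENNReal.toReal_le_toReal (measure_ne_top _ _) (measure_ne_top _ _)]
  change P.real _ ≤ P.real _
  have hu : P {ω | X ω ≤ t} = P {ω | X' ω ≤ t} := hXX'.measure_mem_eq measurableSet_Iic
  have hv : P {ω | Y ω ≤ s} = P {ω | Y' ω ≤ s} := hYY'.measure_mem_eq measurableSet_Iic
  have h0 : 0 ≤ P.real {ω | X' ω > t ∧ Y' ω > s} := measureReal_nonneg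
  have h1 : 0 ≤ P.real {ω | X' ω ≤ t ∧ Y' ω ≤ s} := measureReal_nonneg
  have hcop : P.real {ω | X ω ≤ t ∧ Y ω ≤ s} =
      max (P.real {ω | X ω ≤ t} + P.real {ω | Y ω ≤ s} - 1) 0 := by
    rw [← hC _ ⟨measureReal_nonneg, measureReal_le_one⟩ _ ⟨measureReal_nonneg, measureReal_le_one⟩]
    exact hXY t s
  rw [measureReal_gt_and_gt hX' hY'] at h0 ⊢
  rw [measureReal_gt_and_gt hX hY, hcop]
  simp only [measureReal_def, hu, hv] at *
  rcases max_cases ((P {ω | X' ω ≤ t}).toReal + (P {ω | Y' ω ≤ s}).toReal - 1) 0 with hm | hm <;>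
    linarith

lemma univOptimal_of_countermonotonic {P : Measure Ω} [IsProbabilityMeasure P] {h : ℝ → ℝ}
    (hd : IsDistortion h) (hconc : ConcaveOn ℝ (Icc 0 1) h) {C : ℝ → ℝ → ℝ}
    (hC : ∀ u ∈ Icc (0 : ℝ) 1, ∀ v ∈ Icc (0 : ℝ) 1, C u v = max (u + v - 1) 0) :
    UnivOptimal P h C := by
  rintro X Y X' Y' ⟨hX, MX, hMX⟩ ⟨hY, MY, hMY⟩ ⟨hX', MX', hMX'⟩ ⟨hY', MY', hMY'⟩ hXY hXX' hYY'
  set L := max (max (MX + MY) (MX' + MY')) 0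
  have hL : ∀ ω, |X ω + Y ω| ≤ L := fun ω =>
    (abs_add_le _ _).trans ((add_le_add (hMX ω) (hMY ω)).trans (by simp [L]))
  have hL' : ∀ ω, |X' ω + Y' ω| ≤ L := fun ω =>
    (abs_add_le _ _).trans ((add_le_add (hMX' ω) (hMY' ω)).trans (by simp [L]))
  have hL0 : 0 ≤ L := le_max_right _ _
  obtain ⟨e, -⟩ := distExp_add_eq (P := P) hd hL hL0
  obtain ⟨e', fin'⟩ := distExp_add_eq (P := P) hd hL' hL0
  refine le_of_add_le_add_right (a := L) ?_
  rw [e, e']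
  refine ENNReal.toReal_mono fin' ?_
  refine lintegral_distortion_le hd hconc (antitone_survival P _) (antitone_survival P _)
    (survival_mem_Icc P _) (survival_mem_Icc P _) fun W hW => ?_
  simp only [ENNReal.ofReal_toReal (measure_ne_top P _)]
  refine setLIntegral_le_of_upperSet _ (fun a => ?_) hW
  rw [setLIntegral_survival_add hX hY, setLIntegral_survival_add hX' hY']
  exact lintegral_mono fun t => measure_gt_and_gt_le hC hX hY hX' hY' hXY hXX' hYY' _ _

/-- The distorted expectation of a sum of two indicators. -/
lemma distExp_indicator_add_indicator {P : Measure Ω} [IsProbabilityMeasure P] {h : ℝ → ℝ}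
    (hd : IsDistortion h) (D E : Set Ω) :
    distExp P h (fun ω => D.indicator 1 ω + E.indicator 1 ω) =
      h (P.real (D ∪ E)) + h (P.real (D ∩ E)) := by
  classical
  set Z : Ω → ℝ := fun ω => D.indicator 1 ω + E.indicator 1 ω with hZ
  have hval : ∀ ω, Z ω = (if ω ∈ D then 1 else 0) + (if ω ∈ E then 1 else 0) := fun ω => by
    simp [hZ, indicator_apply]
  have hneg : ∀ x < 0, {ω | Z ω > x} = univ := by
    intro x hx
    ext ω
    simp only [mem_ofPred_eq, mem_univ, iff_true, hval]
    split_ifs <;> linarith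
  have hlow : ∀ x, 0 ≤ x → x < 1 → {ω | Z ω > x} = D ∪ E := by
    intro x hx hx'
    ext ω
    simp only [mem_ofPred_eq, mem_union, hval]
    by_cases h1 : ω ∈ D <;> by_cases h2 : ω ∈ E <;> simp [h1, h2] <;> linarith
  have hmid : ∀ x, 1 ≤ x → x < 2 → {ω | Z ω > x} = D ∩ E := by
    intro x hx hx'
    ext ω
    simp only [mem_ofPred_eq, mem_inter_iff, hval]
    by_cases h1 : ω ∈ D <;> by_cases h2 : ω ∈ E <;> simp [h1, h2] <;> linarith
  have hhigh : ∀ x, 2 ≤ x → {ω | Z ω > x} = ∅ := by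
    intro x hx
    ext ω
    simp only [mem_ofPred_eq, mem_empty_iff_false, iff_false, hval]
    split_ifs <;> linarith
  have h1 : ∫ x in Iio (0 : ℝ), (h (P {ω | Z ω > x}).toReal - 1) = 0 := by
    refine setIntegral_eq_zero_of_forall_eq_zero fun x hx => ?_
    simp [hneg x hx, hd.2.2]
  have h2 : ∀ x ∈ Ioi (0 : ℝ), h (P {ω | Z ω > x}).toReal =
      (Ioo (0 : ℝ) 1).indicator (fun _ => h (P.real (D ∪ E))) x +
        (Ico (1 : ℝ) 2).indicator (fun _ => h (P.real (D ∩ E))) x := by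
    intro x hx
    have hx : 0 < x := hx
    rcases lt_or_ge x 1 with hx1 | hx1
    · simp [hlow x hx.le hx1, indicator, hx, hx1, hx1.not_ge, measureReal_def]
    rcases lt_or_ge x 2 with hx2 | hx2
    · simp [hmid x hx1 hx2, indicator, hx1, hx2, hx1.not_gt, measureReal_def]
    · simp [hhigh x hx2, indicator, hx1.not_gt, hx2.not_gt, hd.2.1]
  have hi : ∀ (c : ℝ) (s : Set ℝ), MeasurableSet s → volume s ≠ ⊤ →
      IntegrableOn (s.indicator fun _ => c) (Ioi 0) := fun c s hs hs' =>
    ((integrable_indicator_iff hs).2 (integrableOn_const hs')).integrableOn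
  change (∫ x in Ioi (0 : ℝ), h (P {ω | Z ω > x}).toReal) +
    (∫ x in Iio (0 : ℝ), (h (P {ω | Z ω > x}).toReal - 1)) = _
  rw [h1, setIntegral_congr_fun measurableSet_Ioi h2,
    integral_add (hi _ _ measurableSet_Ioo (by simp)) (hi _ _ measurableSet_Ico (by simp)),
    setIntegral_indicator measurableSet_Ioo, setIntegral_indicator measurableSet_Ico,
    inter_eq_right.2 Ioo_subset_Ioi_self,
    inter_eq_right.2 (fun x hx => mem_Ioi.2 (zero_lt_one.trans_le hx.1))]
  simp
  norm_num

lemma isBddRV_indicator {D : Set Ω} (hD : MeasurableSet D) : IsBddRV (D.indicator (1 : Ω → ℝ)) := by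
  refine ⟨measurable_one.indicator hD, 1, fun ω => ?_⟩
  by_cases h : ω ∈ D <;> simp [h]

lemma identDistrib_indicator {P : Measure Ω} [IsProbabilityMeasure P] {D E : Set Ω}
    (hD : MeasurableSet D) (hE : MeasurableSet E) (h : P.real D = P.real E) :
    IdentDistrib (D.indicator (1 : Ω → ℝ)) (E.indicator (1 : Ω → ℝ)) P P := by
  refine ⟨(measurable_one.indicator hD).aemeasurable, (measurable_one.indicator hE).aemeasurable,
    Measure.ext fun s hs => ?_⟩
  classical
  have h' : P D = P E := (measureReal_eq_measureReal_iff).1 h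
  have hc : P Dᶜ = P Eᶜ := by rw [prob_compl_eq_one_sub hD, prob_compl_eq_one_sub hE, h']
  rw [Measure.map_apply (measurable_one.indicator hD) hs,
    Measure.map_apply (measurable_one.indicator hE) hs]
  have key : ∀ A : Set Ω, A.indicator (1 : Ω → ℝ) ⁻¹' s =
      (if (1 : ℝ) ∈ s then A else ∅) ∪ (if (0 : ℝ) ∈ s then Aᶜ else ∅) := by
    intro A
    exact indicator_const_preimage_eq_union A s (1 : ℝ)
  rw [key, key]
  split_ifs <;> simp [h', hc]

lemma indicator_le_setOf {α : Type*} {D : Set α} (x : ℝ) :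
    {ω | D.indicator (1 : α → ℝ) ω ≤ x} = if x < 0 then ∅ else if x < 1 then Dᶜ else univ := by
  ext ω
  by_cases h : ω ∈ D <;> split_ifs with h1 h2 <;> simp [h] <;> linarith

lemma hasCopula_indicator {P : Measure Ω} [IsProbabilityMeasure P] {C : ℝ → ℝ → ℝ}
    (hC : IsCopula C) {D E : Set Ω} (hDE : P.real (Dᶜ ∩ Eᶜ) = C (P.real Dᶜ) (P.real Eᶜ)) :
    HasCopula P (D.indicator 1) (E.indicator 1) C := by
  intro x y
  have hmem : ∀ A : Set Ω, (P A).toReal ∈ Icc (0 : ℝ) 1 := fun A =>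
    ⟨measureReal_nonneg, measureReal_le_one⟩
  have hD := hC.1 _ (hmem Dᶜ)
  have hE := hC.1 _ (hmem Eᶜ)
  have h0 := hC.1 0 (by simp)
  have h1 := hC.1 1 (by simp)
  simp only [measureReal_def] at hDE
  rw [ofPred_and, indicator_le_setOf, indicator_le_setOf]
  split_ifs <;> simp [*]

/-- A universally optimal copula for a strictly concave distortion is the lower Fréchet bound. -/
lemma UnivOptimal.eq_max {P : Measure Ω} [IsProbabilityMeasure P] (hP : AtomlessProb P)
    {h : ℝ → ℝ} (hd : IsDistortion h) (hconc : StrictConcaveOn ℝ (Icc 0 1) h) {C : ℝ → ℝ → ℝ}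
    (hC : IsCopula C) (hopt : UnivOptimal P h C) {u v : ℝ} (hu : u ∈ Icc (0 : ℝ) 1)
    (hv : v ∈ Icc (0 : ℝ) 1) : C u v = max (u + v - 1) 0 := by
  have z : (0 : ℝ) ∈ Icc (0 : ℝ) 1 := by simp
  have o : (1 : ℝ) ∈ Icc (0 : ℝ) 1 := by simp
  obtain ⟨u0, u0', u1, u1'⟩ := hC.1 u hu
  obtain ⟨v0, v0', v1, v1'⟩ := hC.1 v hv
  obtain ⟨o0, z1, o1, -⟩ := hC.1 1 o
  obtain ⟨z0, -, -, -⟩ := hC.1 0 z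
  have c0 := hC.2 0 u 0 v z hu z hv hu.1 hv.1
  have cu := hC.2 u 1 0 v hu o z hv hu.2 hv.1
  have cv := hC.2 0 u v 1 z hu hv o hu.1 hv.2
  have cw := hC.2 u 1 v 1 hu o hv o hu.2 hv.2
  set c := C u v with hc
  set c₀ := max (u + v - 1) 0 with hc₀
  have hc₀c : c₀ ≤ c := max_le (by linarith) (by linarith)
  have hc₀0 : 0 ≤ c₀ := le_max_right _ _
  have hc₀1 : u + v - 1 ≤ c₀ := le_max_left _ _
  by_contra hne
  have hlt : c₀ < c := lt_of_le_of_ne hc₀c (Ne.symm hne)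
  obtain ⟨D, -, hD, hDu⟩ := hP.exists_subset_measureReal_eq MeasurableSet.univ
    (show 0 ≤ 1 - u by linarith [hu.2]) (by simpa using hu.1)
  obtain ⟨E, hE, hEv, hDE⟩ := hP.exists_measureReal_eq_inter_eq hD (b := 1 - v)
    (d := 1 - u - v + c) (by linarith) (by linarith) (by linarith) (by linarith)
  obtain ⟨E', hE', hEv', hDE'⟩ := hP.exists_measureReal_eq_inter_eq hD (b := 1 - v)
    (d := 1 - u - v + c₀) (by linarith) (by linarith) (by linarith) (by linarith)
  have hU : P.real (D ∪ E) = 1 - c := by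
    linarith [measureReal_union_add_inter (μ := P) (s := D) hE]
  have hU' : P.real (D ∪ E') = 1 - c₀ := by
    linarith [measureReal_union_add_inter (μ := P) (s := D) hE']
  have hcop : HasCopula P (D.indicator 1) (E.indicator 1) C := by
    refine hasCopula_indicator hC ?_
    rw [← compl_union, probReal_compl_eq_one_sub (hD.union hE), probReal_compl_eq_one_sub hD,
      probReal_compl_eq_one_sub hE, hU, hDu, hEv, sub_sub_cancel, sub_sub_cancel, sub_sub_cancel]
  have hle := hopt _ _ _ _ (isBddRV_indicator hD) (isBddRV_indicator hE) (isBddRV_indicator hD)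
    (isBddRV_indicator hE') hcop (identDistrib_indicator hD hD rfl)
    (identDistrib_indicator hE hE' (hEv.trans hEv'.symm))
  rw [distExp_indicator_add_indicator hd, distExp_indicator_add_indicator hd, hU, hU', hDE,
    hDE'] at hle
  set p := 1 - u - v + c₀ with hp
  set q := 1 - c₀ with hq
  have hpq : 0 < q - p := by linarith
  set s := (c - c₀) / (q - p) with hs
  have hs0 : 0 < s := div_pos (by linarith) hpq
  have hs1 : s < 1 := by
    rw [hs, div_lt_one hpq]
    linarith
  have hsm : s * (q - p) = c - c₀ := div_mul_cancel₀ _ hpq.ne'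
  have hpI : p ∈ Icc (0 : ℝ) 1 := ⟨by linarith, by linarith [hu.1, hv.1]⟩
  have hqI : q ∈ Icc (0 : ℝ) 1 := ⟨by linarith [hu.2], by linarith⟩
  have k1 := hconc.2 hpI hqI (by linarith) (sub_pos.2 hs1) hs0 (by ring)
  have k2 := hconc.2 hpI hqI (by linarith) hs0 (sub_pos.2 hs1) (by ring)
  simp only [smul_eq_mul] at k1 k2
  rw [show (1 - s) * p + s * q = 1 - u - v + c by linarith] at k1
  rw [show s * p + (1 - s) * q = 1 - c by linarith] at k2
  linarith

/-- For a strictly concave distortion function h, a copula C is universally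
optimal for h with linear cost iff C = C⁻, the counter-monotonic copula. -/
theorem univOptimal_iff_countermonotonic_of_strictConcave
    (P : Measure Ω) [IsProbabilityMeasure P] (hP : AtomlessProb P)
    (h : ℝ → ℝ) (hdist : IsDistortion h) (hconc : StrictConcaveOn ℝ (Icc 0 1) h)
    (C : ℝ → ℝ → ℝ) (hC : IsCopula C) :
    UnivOptimal P h C ↔
      ∀ u ∈ Icc (0:ℝ) 1, ∀ v ∈ Icc (0:ℝ) 1, C u v = max (u + v - 1) 0 := by
  exact ⟨fun hopt u hu v hv => hopt.eq_max hP hdist hconc hC hu hv,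
    fun h' => univOptimal_of_countermonotonic hdist hconc.concaveOn h'⟩
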